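/- arXiv:2310.08639 — 4 statements merged into one kernel-verified Lean document; each statement's English description precedes it below -/
import Mathlib

section
/- Attraction to the noiseless fixed point under majority-vote renormalization (Section 5.1): For every odd natural number b ≥ 3 and every real p with 0 < p < 1/2, the renormalized noise strength strictly decreases: f_b(p) < p. Consequently p = 0 is a stable fixed point attracting the whole interval [0, 1/2), i.e., for any p₀ ∈ [0,1/2) the iterates p_{n+1} = f_b(p_n) converge to 0. -/
noncomputable section

/-- Renormalized bit-flip noise strength after one majority-vote coarse-graining step on
blocks of `b` qubits: `f_b(p) = ∑_{k=(b+1)/2}^{b} (b choose k) pᵏ (1−p)^{b−k}`, the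
probability that a majority of `b` independent Bernoulli(`p`) bits equal 1. -/
def majVoteFlow (b : ℕ) (p : ℝ) : ℝ :=
  ∑ k ∈ Finset.Icc ((b + 1) / 2) b, (b.choose k : ℝ) * p ^ k * (1 - p) ^ (b - k)

/-- Flipping the roles of 0 and 1 turns the upper binomial tail into a lower one. -/
theorem majVoteFlow_eq_sum_range (m : ℕ) (p : ℝ) :
    majVoteFlow (2 * m + 1) p =
      ∑ j ∈ Finset.range (m + 1),
        ((2 * m + 1).choose j : ℝ) * p ^ (2 * m + 1 - j) * (1 - p) ^ j := by
  rw [majVoteFlow, show (2 * m + 1 + 1) / 2 = m + 1 by omega]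
  refine Finset.sum_nbij' (fun k => 2 * m + 1 - k) (fun j => 2 * m + 1 - j) ?_ ?_ ?_ ?_ ?_
  · intro k hk
    simp only [Finset.mem_Icc, Finset.mem_range] at *
    omega
  · intro k hk
    simp only [Finset.mem_Icc, Finset.mem_range] at *
    omega
  · intro k hk
    simp only [Finset.mem_Icc] at *
    omega
  · intro k hk
    simp only [Finset.mem_range] at *
    omega
  · intro k hk
    have hk' : k ≤ 2 * m + 1 := (Finset.mem_Icc.1 hk).2
    rw [Nat.choose_symm hk', Nat.sub_sub_self hk']

/-- The lower binomial tail complements the majority probability. -/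
theorem sum_range_add_majVoteFlow (m : ℕ) (p : ℝ) :
    ∑ j ∈ Finset.range (m + 1),
        ((2 * m + 1).choose j : ℝ) * p ^ j * (1 - p) ^ (2 * m + 1 - j) +
      majVoteFlow (2 * m + 1) p = 1 := by
  have h := add_pow p (1 - p) (2 * m + 1)
  rw [add_sub_cancel, one_pow] at h
  rw [majVoteFlow, show (2 * m + 1 + 1) / 2 = m + 1 by omega,
    ← Finset.Ico_add_one_right_eq_Icc, Finset.sum_range_add_sum_Ico _ (by omega)]
  exact (Finset.sum_congr rfl fun k _ => by ring).trans h.symm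

theorem majVoteFlow_lt_self {b : ℕ} (hb : 3 ≤ b) (hodd : Odd b) {p : ℝ} (hp : 0 < p)
    (hp' : p < 1 / 2) : majVoteFlow b p < p := by
  obtain ⟨m, rfl⟩ := hodd
  have hq : 0 < 1 - p := by linarith
  have hpq : p < 1 - p := by linarith
  have key : (1 - p) * majVoteFlow (2 * m + 1) p <
      p * ∑ j ∈ Finset.range (m + 1),
        ((2 * m + 1).choose j : ℝ) * p ^ j * (1 - p) ^ (2 * m + 1 - j) := by
    rw [majVoteFlow_eq_sum_range, Finset.mul_sum, Finset.mul_sum]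
    have hterm : ∀ j ≤ m,
        (1 - p) * (((2 * m + 1).choose j : ℝ) * p ^ (2 * m + 1 - j) * (1 - p) ^ j) =
          ((2 * m + 1).choose j * p ^ (j + 1) * (1 - p) ^ (j + 1)) * p ^ (2 * (m - j)) ∧
        p * (((2 * m + 1).choose j : ℝ) * p ^ j * (1 - p) ^ (2 * m + 1 - j)) =
          ((2 * m + 1).choose j * p ^ (j + 1) * (1 - p) ^ (j + 1)) * (1 - p) ^ (2 * (m - j)) := by
      intro j hj
      rw [show 2 * m + 1 - j = (j + 1) + 2 * (m - j) by omega, pow_add p (j + 1) (2 * (m - j)),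
        pow_add (1 - p) (j + 1) (2 * (m - j))]
      constructor <;> ring
    refine Finset.sum_lt_sum (fun j hj => ?_) ⟨0, by simp, ?_⟩
    · obtain ⟨h₁, h₂⟩ := hterm j (by simpa [Nat.lt_succ_iff] using hj)
      rw [h₁, h₂]
      gcongr
    · obtain ⟨h₁, h₂⟩ := hterm 0 (Nat.zero_le m)
      rw [h₁, h₂]
      have hlt : p ^ (2 * (m - 0)) < (1 - p) ^ (2 * (m - 0)) :=
        pow_lt_pow_left₀ hpq hp.le (by omega)
      exact mul_lt_mul_of_pos_left hlt (by simp only [Nat.choose_zero_right]; positivity)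
  linear_combination key + p * sum_range_add_majVoteFlow m p

theorem majVoteFlow_nonneg (b : ℕ) {p : ℝ} (hp : 0 ≤ p) (hp' : p ≤ 1) : 0 ≤ majVoteFlow b p := by
  have : 0 ≤ 1 - p := by linarith
  exact Finset.sum_nonneg fun k _ => by positivity

theorem majVoteFlow_zero (b : ℕ) (hb : 1 ≤ b) : majVoteFlow b 0 = 0 := by
  refine Finset.sum_eq_zero fun k hk => ?_
  have : k ≠ 0 := by
    have := (Finset.mem_Icc.1 hk).1
    omega
  simp [this]

theorem continuous_majVoteFlow (b : ℕ) : Continuous (majVoteFlow b) := by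
  unfold majVoteFlow
  fun_prop

/-- **Attraction to the noiseless fixed point under majority-vote renormalization**
(Section 5.1): for `0 < p < 1/2` the renormalized noise strength strictly decreases,
`f_b(p) < p`; consequently `p = 0` attracts the whole interval `[0, 1/2)`: any sequence of
iterates `p_{n+1} = f_b(p_n)` starting in `[0, 1/2)` converges to `0`. -/
theorem majVoteFlow_attracts_to_zero (b : ℕ) (hb : 3 ≤ b) (hodd : Odd b) :
    (∀ p : ℝ, 0 < p → p < 1 / 2 → majVoteFlow b p < p) ∧
    (∀ p₀ : ℝ, 0 ≤ p₀ → p₀ < 1 / 2 → ∀ q : ℕ → ℝ, q 0 = p₀ →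
      (∀ n, q (n + 1) = majVoteFlow b (q n)) →
      Filter.Tendsto q Filter.atTop (nhds 0)) := by
  refine ⟨fun p => majVoteFlow_lt_self hb hodd, fun p₀ h0 h1 q hq0 hq => ?_⟩
  have hle : ∀ p : ℝ, 0 ≤ p → p < 1 / 2 → majVoteFlow b p ≤ p := by
    intro p hp hp'
    rcases hp.eq_or_lt with rfl | hp
    · exact (majVoteFlow_zero b (by omega)).le
    · exact (majVoteFlow_lt_self hb hodd hp hp').le
  have hmem : ∀ n, 0 ≤ q n ∧ q n < 1 / 2 := by
    intro n
    induction n with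
    | zero => exact hq0 ▸ ⟨h0, h1⟩
    | succ n ih =>
      rw [hq]
      exact ⟨majVoteFlow_nonneg b ih.1 (by linarith), (hle _ ih.1 ih.2).trans_lt ih.2⟩
  have hanti : Antitone q :=
    antitone_nat_of_succ_le fun n => hq n ▸ hle _ (hmem n).1 (hmem n).2
  have hbdd : BddBelow (Set.range q) := ⟨0, Set.forall_mem_range.2 fun n => (hmem n).1⟩
  have hlim := tendsto_atTop_ciInf hanti hbdd
  have hL0 : 0 ≤ ⨅ n, q n := le_ciInf fun n => (hmem n).1
  have hL1 : ⨅ n, q n < 1 / 2 := (ciInf_le hbdd 0).trans_lt (hmem 0).2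
  have hfix : majVoteFlow b (⨅ n, q n) = ⨅ n, q n := by
    refine tendsto_nhds_unique (((continuous_majVoteFlow b).tendsto _).comp hlim) ?_
    exact ((Filter.tendsto_add_atTop_iff_nat 1).2 hlim).congr hq
  rcases hL0.eq_or_lt with hL | hL
  · rwa [← hL] at hlim
  · exact absurd hfix (majVoteFlow_lt_self hb hodd hL hL1).ne

end
end

section
/- Quantitative contraction of the majority-vote renormalization map (Appendix B.2): For every odd natural number b ≥ 3 and every real p ∈ [0,1], one has f_b(p) ≤ 2^{b−1} · p^{(b+1)/2} (real exponent (b+1)/2). Moreover, if in addition 0 ≤ p ≤ 2^{2−2b}, then f_b(p) ≤ p^{b/2} (real exponent b/2). -/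
noncomputable section

theorem sum_Icc_choose_halfway (m : ℕ) :
    ∑ k ∈ Finset.Icc (m + 1) (2 * m + 1), (2 * m + 1).choose k = 4 ^ m := by
  rw [← Nat.sum_range_choose_halfway m]
  refine Finset.sum_nbij' (fun k => 2 * m + 1 - k) (fun k => 2 * m + 1 - k) ?_ ?_ ?_ ?_ ?_
  · intro k hk
    simp only [Finset.mem_Icc, Finset.mem_range] at hk ⊢
    omega
  · intro k hk
    simp only [Finset.mem_Icc, Finset.mem_range] at hk ⊢
    omega
  · intro k hk
    simp only [Finset.mem_Icc] at hk
    omega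
  · intro k hk
    simp only [Finset.mem_range] at hk
    omega
  · intro k hk
    exact (Nat.choose_symm (Finset.mem_Icc.mp hk).2).symm

theorem majVoteFlow_le_pow (m : ℕ) {p : ℝ} (hp0 : 0 ≤ p) (hp1 : p ≤ 1) :
    majVoteFlow (2 * m + 1) p ≤ 4 ^ m * p ^ (m + 1) := by
  have hsum : (4 : ℝ) ^ m = ∑ k ∈ Finset.Icc (m + 1) (2 * m + 1), ((2 * m + 1).choose k : ℝ) := by
    exact_mod_cast (sum_Icc_choose_halfway m).symm
  rw [majVoteFlow, show (2 * m + 1 + 1) / 2 = m + 1 by omega, hsum, Finset.sum_mul]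
  refine Finset.sum_le_sum fun k hk => ?_
  have hpk : p ^ k ≤ p ^ (m + 1) := pow_le_pow_of_le_one hp0 hp1 (Finset.mem_Icc.mp hk).1
  have hq : (1 - p) ^ (2 * m + 1 - k) ≤ 1 := pow_le_one₀ (by linarith) (by linarith)
  calc ((2 * m + 1).choose k : ℝ) * p ^ k * (1 - p) ^ (2 * m + 1 - k)
      ≤ (2 * m + 1).choose k * p ^ k := mul_le_of_le_one_right (by positivity) hq
    _ ≤ (2 * m + 1).choose k * p ^ (m + 1) := by gcongr

/-- **Quantitative contraction of the majority-vote renormalization map** (Appendix B.2):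
`f_b(p) ≤ 2^{b−1} p^{(b+1)/2}` for `p ∈ [0,1]`, and moreover `f_b(p) ≤ p^{b/2}` whenever
`0 ≤ p ≤ 2^{2−2b}` (real exponents). -/
theorem majVoteFlow_contraction (b : ℕ) (hb : 3 ≤ b) (hodd : Odd b) (p : ℝ)
    (hp0 : 0 ≤ p) (hp1 : p ≤ 1) :
    majVoteFlow b p ≤ 2 ^ (b - 1) * p ^ (((b : ℝ) + 1) / 2) ∧
    (p ≤ (2 : ℝ) ^ ((2 : ℝ) - 2 * (b : ℝ)) → majVoteFlow b p ≤ p ^ ((b : ℝ) / 2)) := by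
  obtain ⟨m, rfl⟩ := hodd
  have hmain := majVoteFlow_le_pow m hp0 hp1
  refine ⟨?_, fun hp => hmain.trans ?_⟩
  · have hexp : (((2 * m + 1 : ℕ) : ℝ) + 1) / 2 = (m + 1 : ℕ) := by
      push_cast
      ring
    rwa [hexp, Real.rpow_natCast, Nat.add_sub_cancel, pow_mul, show (2 : ℝ) ^ 2 = 4 by norm_num]
  · have hexp : ((2 * m + 1 : ℕ) : ℝ) / 2 = m + 1 / 2 := by
      push_cast
      ring
    have hthreshold : (2 : ℝ) ^ ((2 : ℝ) - 2 * ((2 * m + 1 : ℕ) : ℝ)) = ((4 ^ m)⁻¹) ^ 2 := by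
      rw [show (2 : ℝ) - 2 * ((2 * m + 1 : ℕ) : ℝ) = -((4 * m : ℕ) : ℝ) by push_cast; ring,
        Real.rpow_neg zero_le_two, Real.rpow_natCast, inv_pow, ← pow_mul,
        show (4 : ℝ) = 2 ^ 2 by norm_num, ← pow_mul]
      congr 2
      ring
    have hsqrt : √p ≤ (4 ^ m)⁻¹ := Real.sqrt_le_iff.mpr ⟨by positivity, hthreshold ▸ hp⟩
    rw [hexp, Real.rpow_add_of_nonneg hp0 (by positivity) (by positivity), Real.rpow_natCast,
      ← Real.sqrt_eq_rpow]
    calc 4 ^ m * p ^ (m + 1) = 4 ^ m * √p * (p ^ m * √p) := by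
          rw [pow_succ]
          nth_rewrite 2 [← Real.mul_self_sqrt hp0]
          ring
      _ ≤ 4 ^ m * (4 ^ m)⁻¹ * (p ^ m * √p) := by gcongr
      _ = p ^ m * √p := by rw [mul_inv_cancel₀ (by positivity), one_mul]

end
end

section
/- Renormalization of Z-dephasing noise through the repetition encoding (Eq. (54), Section 5.2): Let b ≥ 1 be a natural number and p ∈ ℝ, and set p' := (1 − (1−2p)^b)/2. Let w : Matrix (Fin b → Bool) Bool ℂ be the repetition-code isometry with w(t, x) = 1 if t is the constant function x and 0 otherwise, and for s : Fin b → Bool let Z_s be the diagonal matrix with diagonal entry (−1)^{#{i : s i = true ∧ t i = true}} at t. Then for every M : Matrix Bool Bool ℂ: Σ_{s : Fin b → Bool} p^{|s|} (1−p)^{b−|s|} · Z_s (w M wᴴ) Z_s = w ((1−p')·M + p'·(Z M Z)) wᴴ, where Z := diagonal matrix with entries (1, −1) on Bool and |s| is the number of indices with s i = true. That is, b-fold independent single-qubit Z-dephasing with strength p applied after the repetition encoding equals the encoding applied after a single-qubit Z-dephasing of renormalized strength p'. -/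
open Matrix

noncomputable section

/-- Hamming weight of a bit string: the number of indices where it is `true`. -/
def hammingWt {b : ℕ} (s : Fin b → Bool) : ℕ :=
  (Finset.univ.filter fun i => s i = true).card

/-- The repetition-code isometry `w : Matrix (Fin b → Bool) Bool ℂ`,
`w(t, x) = 1` iff `t` is the constant function `x`. -/
def repIso (b : ℕ) : Matrix (Fin b → Bool) Bool ℂ :=
  fun t x => if t = fun _ => x then 1 else 0

/-- The single-qubit Pauli `Z`: the diagonal matrix with entries `(1, −1)` on `Bool`. -/
def pauliZ : Matrix Bool Bool ℂ :=
  Matrix.diagonal fun x => if x then -1 else 1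

/-- The multi-qubit phase operator `Z_s`: diagonal with entry
`(−1)^{#{i : s i = true ∧ t i = true}}` at `t`. -/
def pauliZs {b : ℕ} (s : Fin b → Bool) : Matrix (Fin b → Bool) (Fin b → Bool) ℂ :=
  Matrix.diagonal fun t =>
    (-1 : ℂ) ^ (Finset.univ.filter fun i => s i = true ∧ t i = true).card

theorem sum_pow_hammingWt_mul_pow {R : Type*} [CommSemiring R] (b : ℕ) (x y : R) :
    ∑ s : Fin b → Bool, x ^ hammingWt s * y ^ (b - hammingWt s) = (x + y) ^ b := by
  have h := Fintype.sum_pow (fun t : Bool => if t then x else y) b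
  simp only [Fintype.sum_bool, if_true, Bool.false_eq_true, if_false] at h
  rw [h]
  refine Finset.sum_congr rfl fun s _ => ?_
  have hc := Finset.card_filter_add_card_filter_not (s := (Finset.univ : Finset (Fin b)))
    (fun i => s i = true)
  rw [Finset.card_univ, Fintype.card_fin] at hc
  rw [Finset.prod_ite, Finset.prod_const, Finset.prod_const, hammingWt,
    Nat.sub_eq_of_eq_add' hc.symm]

theorem pauliZs_mul_repIso {b : ℕ} (s : Fin b → Bool) :
    pauliZs s * repIso b = repIso b * pauliZ ^ hammingWt s := by
  ext t x
  rw [pauliZs, pauliZ, Matrix.diagonal_pow, Matrix.diagonal_mul, Matrix.mul_diagonal]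
  by_cases h : t = fun _ => x
  · subst h
    cases x <;> simp [repIso, hammingWt]
  · simp [repIso, h]

theorem conjTranspose_pauliZ : pauliZᴴ = pauliZ := by
  rw [pauliZ, Matrix.diagonal_conjTranspose]
  congr 1
  ext x
  cases x <;> simp

theorem conjTranspose_pauliZs {b : ℕ} (s : Fin b → Bool) : (pauliZs s)ᴴ = pauliZs s := by
  rw [pauliZs, Matrix.diagonal_conjTranspose]
  congr 1
  ext t
  simp

theorem conjTranspose_repIso_mul_pauliZs {b : ℕ} (s : Fin b → Bool) :
    (repIso b)ᴴ * pauliZs s = pauliZ ^ hammingWt s * (repIso b)ᴴ := by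
  have h := congrArg Matrix.conjTranspose (pauliZs_mul_repIso s)
  rwa [Matrix.conjTranspose_mul, Matrix.conjTranspose_mul, Matrix.conjTranspose_pow,
    conjTranspose_pauliZs, conjTranspose_pauliZ] at h

/-- Averaging the powers of `Z`-conjugation over independent phase flips of probability `p`
gives a `Z`-dephasing channel. -/
theorem sum_smul_pauliZ_pow_conj (b : ℕ) (p : ℂ) (M : Matrix Bool Bool ℂ) :
    ∑ s : Fin b → Bool, (p ^ hammingWt s * (1 - p) ^ (b - hammingWt s)) •
        (pauliZ ^ hammingWt s * M * pauliZ ^ hammingWt s)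
      = (1 - (1 - (1 - 2 * p) ^ b) / 2) • M
        + ((1 - (1 - 2 * p) ^ b) / 2) • (pauliZ * M * pauliZ) := by
  have h₁ := sum_pow_hammingWt_mul_pow b p (1 - p)
  have h₂ := sum_pow_hammingWt_mul_pow b (-p) (1 - p)
  rw [add_sub_cancel, one_pow] at h₁
  rw [show -p + (1 - p) = 1 - 2 * p by ring] at h₂
  ext x y
  simp only [Matrix.sum_apply, Matrix.smul_apply, Matrix.add_apply, pauliZ,
    Matrix.diagonal_pow, Matrix.diagonal_mul, Matrix.mul_diagonal, smul_eq_mul, Pi.pow_apply]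
  by_cases hxy : x = y
  · subst hxy
    trans (∑ s : Fin b → Bool, p ^ hammingWt s * (1 - p) ^ (b - hammingWt s)) * M x x
    · rw [Finset.sum_mul]
      refine Finset.sum_congr rfl fun s _ => ?_
      cases x <;> simp [mul_right_comm _ (M _ _), ← mul_pow]
    · rw [h₁]
      cases x <;> simp <;> ring
  · trans (1 - 2 * p) ^ b * M x y
    · rw [← h₂, Finset.sum_mul]
      refine Finset.sum_congr rfl fun s _ => ?_
      rw [neg_pow p]
      cases x <;> cases y <;> simp at hxy ⊢ <;> ring
    · cases x <;> cases y <;> simp at hxy ⊢ <;> ring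

/-- **Renormalization of Z-dephasing noise through the repetition encoding** (Eq. (54)):
`b`-fold independent single-qubit Z-dephasing of strength `p` applied after the repetition
encoding equals the encoding applied after single-qubit Z-dephasing of strength
`p' = (1 − (1−2p)^b)/2`. -/
theorem z_dephasing_renormalization (b : ℕ) (hb : 1 ≤ b) (p : ℝ) (p' : ℝ)
    (hp' : p' = (1 - (1 - 2 * p) ^ b) / 2) (M : Matrix Bool Bool ℂ) :
    ∑ s : Fin b → Bool,
      ((p ^ hammingWt s * (1 - p) ^ (b - hammingWt s) : ℝ) : ℂ) •
        (pauliZs s * (repIso b * M * (repIso b)ᴴ) * pauliZs s)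
      = repIso b * (((1 - p' : ℝ) : ℂ) • M + ((p' : ℝ) : ℂ) • (pauliZ * M * pauliZ)) *
          (repIso b)ᴴ := by
  subst hp'
  have h := sum_smul_pauliZ_pow_conj b (p : ℂ) M
  push_cast
  rw [← h, Matrix.mul_sum, Matrix.sum_mul]
  refine Finset.sum_congr rfl fun s _ => ?_
  rw [Matrix.mul_smul, Matrix.smul_mul]
  congr 1
  calc pauliZs s * (repIso b * M * (repIso b)ᴴ) * pauliZs s
      = (pauliZs s * repIso b) * M * ((repIso b)ᴴ * pauliZs s) := by
        simp only [Matrix.mul_assoc]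
    _ = repIso b * (pauliZ ^ hammingWt s * M * pauliZ ^ hammingWt s) * (repIso b)ᴴ := by
        rw [pauliZs_mul_repIso, conjTranspose_repIso_mul_pauliZs]
        simp only [Matrix.mul_assoc]

end
end

section
/- Renormalization of bit-flip noise by the majority-vote channel (Eq. (38), Section 5.1, proved in Appendix A.4): Let b ≥ 3 be odd, p ∈ [0,1], and p' := f_b(p) = Σ_{k=(b+1)/2}^{b} (b choose k) p^k (1−p)^{b−k}. For t : Fin b → Bool write |t| for the number of true entries, maj t := (2·|t| > b), and t̄ for the pointwise negation of t. Let w : Matrix (Fin b → Bool) Bool ℂ be the repetition isometry (w(t,x) = 1 iff t is constant x), for s : Fin b → Bool let X_s be the permutation matrix of coordinatewise XOR with s, and for M : Matrix Bool Bool ℂ set ρ := Σ_s p^{|s|}(1−p)^{b−|s|} X_s (w M wᴴ) X_s. Define the coarse-grained matrix N : Matrix Bool Bool ℂ by N(x,x) := Σ_{t : maj t = x} ρ(t,t) and N(x, ¬x) := Σ_{t : maj t = x} ρ(t, t̄). Then N = (1−p')·M + p'·(X M X), where X is the 2×2 bit-flip matrix on Bool (the permutation matrix of negation). That is, the majority-vote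 coarse-graining turns b-fold bit-flip noise of strength p after repetition encoding into single-qubit bit-flip noise of strength p'. -/
open Matrix

noncomputable section

/-- The majority bit of a bit string: `true` iff strictly more than half the bits are 1. -/
def maj {b : ℕ} (t : Fin b → Bool) : Bool :=
  decide (2 * hammingWt t > b)

/-- The permutation matrix `X_s` of coordinatewise XOR with `s`. -/
def pauliXs {b : ℕ} (s : Fin b → Bool) : Matrix (Fin b → Bool) (Fin b → Bool) ℂ :=
  fun t t' => if (fun i => xor (t i) (s i)) = t' then 1 else 0

/-- The single-qubit bit-flip `X`: the permutation matrix of `Bool`-negation. -/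
def pauliX : Matrix Bool Bool ℂ :=
  fun x y => if y = !x then 1 else 0

/-- Coordinatewise XOR with `s` as a permutation of bit strings. -/
def xorEquiv {b : ℕ} (s : Fin b → Bool) : (Fin b → Bool) ≃ (Fin b → Bool) where
  toFun t := fun i => xor (s i) (t i)
  invFun t := fun i => xor (s i) (t i)
  left_inv t := by funext i; simp
  right_inv t := by funext i; simp

/-- The probability of the error pattern `s` under independent bit flips of strength `p`. -/
def flipProb {b : ℕ} (p : ℝ) (s : Fin b → Bool) : ℝ :=
  p ^ hammingWt s * (1 - p) ^ (b - hammingWt s)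

theorem sum_apply_hammingWt (b : ℕ) (f : ℕ → ℝ) :
    ∑ s : Fin b → Bool, f (hammingWt s) = ∑ k ∈ Finset.range (b + 1), (b.choose k : ℝ) * f k := by
  have h := Finset.sum_powerset_apply_card f (x := (Finset.univ : Finset (Fin b)))
  simp only [Finset.card_univ, Fintype.card_fin, nsmul_eq_mul, Finset.powerset_univ] at h
  rw [← h]
  exact Finset.sum_nbij' (fun s => Finset.univ.filter fun i => s i = true)
    (fun S i => decide (i ∈ S)) (by simp) (by simp) (by intro s _; funext i; simp)
    (by intro S _; ext i; simp) (by intro s _; rfl)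

theorem sum_flipProb (b : ℕ) (p : ℝ) : ∑ s : Fin b → Bool, flipProb p s = 1 := by
  have h := add_pow p (1 - p) b
  rw [add_sub_cancel, one_pow] at h
  rw [h]
  refine (sum_apply_hammingWt b fun k => p ^ k * (1 - p) ^ (b - k)).trans ?_
  exact Finset.sum_congr rfl fun k _ => by ring

theorem sum_flipProb_maj_true {b : ℕ} (hodd : Odd b) (p : ℝ) :
    ∑ s : Fin b → Bool with maj s = true, flipProb p s = majVoteFlow b p := by
  rw [Finset.sum_filter]
  have h := sum_apply_hammingWt b fun k =>
    if 2 * k > b then p ^ k * (1 - p) ^ (b - k) else 0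
  simp only [maj, decide_eq_true_eq, flipProb]
  rw [h, majVoteFlow]
  simp only [mul_ite, mul_zero]
  rw [← Finset.sum_filter]
  refine Finset.sum_congr ?_ fun k _ => by ring
  obtain ⟨m, rfl⟩ := hodd
  ext k
  simp only [Finset.mem_filter, Finset.mem_range, Finset.mem_Icc]
  omega

theorem sum_flipProb_maj_false {b : ℕ} (hodd : Odd b) (p : ℝ) :
    ∑ s : Fin b → Bool with maj s = false, flipProb p s = 1 - majVoteFlow b p := by
  rw [eq_sub_iff_add_eq, ← sum_flipProb_maj_true hodd p, ← sum_flipProb b p, add_comm]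
  simpa using Finset.sum_filter_add_sum_filter_not Finset.univ
    (fun s : Fin b → Bool => maj s = true) (flipProb p)

theorem hammingWt_not_add {b : ℕ} (t : Fin b → Bool) :
    hammingWt (fun i => !(t i)) + hammingWt t = b := by
  have h := Finset.card_filter_add_card_filter_not (s := Finset.univ) (fun i => t i = true)
  simp only [Bool.not_eq_true, Finset.card_univ, Fintype.card_fin] at h
  simp only [hammingWt, Bool.not_eq_true']
  omega

theorem maj_xor {b : ℕ} (hodd : Odd b) (a : Bool) (t : Fin b → Bool) :
    maj (fun i => xor (t i) a) = xor (maj t) a := by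
  cases a with
  | false => simp
  | true =>
    obtain ⟨m, hm⟩ := hodd
    have h := hammingWt_not_add t
    simp only [Bool.xor_true, maj, ← decide_not, decide_eq_decide]
    omega

theorem sum_flipProb_xor {b : ℕ} (hodd : Odd b) (p : ℝ) (x a : Bool) :
    ∑ t : Fin b → Bool with maj t = x, flipProb p (fun i => xor (t i) a) =
      if a = x then 1 - majVoteFlow b p else majVoteFlow b p := by
  have h : ∑ t : Fin b → Bool with maj t = x, flipProb p (fun i => xor (t i) a) =
      ∑ s : Fin b → Bool with maj s = xor x a, flipProb p s := by
    refine Finset.sum_nbij' (fun t i => xor (t i) a) (fun t i => xor (t i) a) ?_ ?_ ?_ ?_ ?_ <;>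
      simp +contextual [maj_xor hodd]
  rw [h]
  cases x <;> cases a <;> simp [sum_flipProb_maj_true hodd, sum_flipProb_maj_false hodd]

theorem pauliXs_conj_apply {b : ℕ} (s : Fin b → Bool)
    (A : Matrix (Fin b → Bool) (Fin b → Bool) ℂ) (t t' : Fin b → Bool) :
    (pauliXs s * A * pauliXs s) t t' =
      A (fun i => xor (t i) (s i)) (fun i => xor (t' i) (s i)) := by
  have h (u : Fin b → Bool) :
      (fun i => xor (u i) (s i)) = t' ↔ u = fun i => xor (t' i) (s i) := by
    constructor
    · rintro rfl; simp
    · rintro rfl; simp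
  simp [Matrix.mul_apply, pauliXs, h]

theorem const_bool_inj {b : ℕ} (hb : 0 < b) (x y : Bool) :
    ((fun _ : Fin b => x) = fun _ => y) ↔ x = y :=
  ⟨fun h => congrFun h ⟨0, hb⟩, fun h => by rw [h]⟩

theorem repIso_conj_apply_xor {b : ℕ} (hb : 0 < b) (M : Matrix Bool Bool ℂ)
    (u : Fin b → Bool) (z : Bool) :
    (repIso b * M * (repIso b)ᴴ) u (fun i => xor (u i) z) =
      ∑ a, if u = (fun _ => a) then M a (xor a z) else 0 := by
  by_cases h : ∃ a, u = fun _ => a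
  · obtain ⟨a, rfl⟩ := h
    simp [Matrix.mul_apply, repIso, const_bool_inj hb]
  · push Not at h
    simp [Matrix.mul_apply, repIso, h]

theorem noisy_repIso_apply_xor {b : ℕ} (hb : 0 < b) (p : ℝ) (M : Matrix Bool Bool ℂ)
    (t : Fin b → Bool) (z : Bool) :
    (∑ s : Fin b → Bool, (flipProb p s : ℂ) •
        (pauliXs s * (repIso b * M * (repIso b)ᴴ) * pauliXs s)) t (fun i => xor (t i) z) =
      ∑ a, (flipProb p (fun i => xor (t i) a) : ℂ) * M a (xor a z) := by
  have h (u : Fin b → Bool) :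
      (fun i => xor (xor (t i) z) (u i)) = fun i => xor (xor (t i) (u i)) z := by
    funext i; rw [Bool.xor_assoc, Bool.xor_comm z, Bool.xor_assoc]
  simp only [Matrix.sum_apply, Matrix.smul_apply, pauliXs_conj_apply, h,
    repIso_conj_apply_xor hb, smul_eq_mul]
  rw [← Equiv.sum_comp (xorEquiv t)]
  simp only [xorEquiv, Equiv.coe_fn_mk, Bool.xor_self, ← Bool.xor_assoc, Bool.false_xor,
    Finset.mul_sum, mul_ite, mul_zero]
  rw [Finset.sum_comm]
  simp

theorem sum_noisy_repIso_maj {b : ℕ} (hb : 0 < b) (hodd : Odd b) (p : ℝ)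
    (M : Matrix Bool Bool ℂ) (x z : Bool) :
    ∑ t : Fin b → Bool with maj t = x,
      (∑ s : Fin b → Bool, (flipProb p s : ℂ) •
        (pauliXs s * (repIso b * M * (repIso b)ᴴ) * pauliXs s)) t (fun i => xor (t i) z) =
      ((1 - majVoteFlow b p : ℝ) : ℂ) * M x (xor x z) +
        (majVoteFlow b p : ℂ) * M (!x) (xor (!x) z) := by
  simp only [noisy_repIso_apply_xor hb]
  rw [Finset.sum_comm]
  simp only [← Finset.sum_mul, ← Complex.ofReal_sum, sum_flipProb_xor hodd]
  cases x <;> simp [add_comm]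

/-- **Renormalization of bit-flip noise by the majority-vote channel** (Eq. (38),
Appendix A.4): majority-vote coarse-graining turns `b`-fold bit-flip noise of strength `p`
applied after the repetition encoding into single-qubit bit-flip noise of strength
`p' = f_b(p)`. -/
theorem majority_vote_renormalization (b : ℕ) (hb : 3 ≤ b) (hodd : Odd b)
    (p : ℝ) (hp0 : 0 ≤ p) (hp1 : p ≤ 1) (p' : ℝ) (hp' : p' = majVoteFlow b p)
    (M : Matrix Bool Bool ℂ) :
    let ρ : Matrix (Fin b → Bool) (Fin b → Bool) ℂ :=
      ∑ s : Fin b → Bool,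
        ((p ^ hammingWt s * (1 - p) ^ (b - hammingWt s) : ℝ) : ℂ) •
          (pauliXs s * (repIso b * M * (repIso b)ᴴ) * pauliXs s)
    let N : Matrix Bool Bool ℂ := fun x y =>
      if y = x then ∑ t ∈ Finset.univ.filter (fun t => maj t = x), ρ t t
      else ∑ t ∈ Finset.univ.filter (fun t => maj t = x), ρ t (fun i => !(t i))
    N = ((1 - p' : ℝ) : ℂ) • M + ((p' : ℝ) : ℂ) • (pauliX * M * pauliX) := by
  subst hp'
  intro ρ N
  ext x y
  have hX : (pauliX * M * pauliX) x y = M (!x) (!y) := by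
    cases x <;> cases y <;> simp [Matrix.mul_apply, pauliX]
  have h (z : Bool) := sum_noisy_repIso_maj (by omega) hodd p M x z
  simp only [Matrix.add_apply, Matrix.smul_apply, smul_eq_mul, hX]
  by_cases hxy : y = x
  · subst hxy
    simpa [N, ρ, flipProb] using h false
  · obtain rfl : y = !x := Bool.eq_not_iff.mpr hxy
    simpa [N, ρ, flipProb] using h true

end
end
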